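/- Let σ be any finite composition of the substitutions L, M, R. Then for every word w in the Thue–Morse language L_{M^∞}, the number of occurrences of the word σ(011) as a factor of σ(w) equals the number of occurrences of 011 as a factor of w, i.e., |σ(w)|_{σ(011)} = |w|_{011}. -/

import Mathlib

open List

/-- Number of occurrences of `v` as a factor of `w`, i.e. the number of
decompositions `w = p ++ v ++ s`. -/
def occ {A : Type*} [DecidableEq A] (v w : List A) : ℕ :=
  (List.range (w.length + 1)).countP (fun i => decide (v <+: w.drop i))

/-- Apply a substitution (given by its values on letters) to a word. -/
def applyS {A B : Type*} (σ : A → List B) (w : List A) : List B :=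
  (w.map σ).flatten

/-- The substitution `L : 0 ↦ 0, 1 ↦ 10` (with `0 = false`, `1 = true`). -/
def Lsub : Bool → List Bool
  | false => [false]
  | true => [true, false]

/-- The (Thue–Morse) substitution `M : 0 ↦ 01, 1 ↦ 10`. -/
def Msub : Bool → List Bool
  | false => [false, true]
  | true => [true, false]

/-- The substitution `R : 0 ↦ 01, 1 ↦ 1`. -/
def Rsub : Bool → List Bool
  | false => [false, true]
  | true => [true]

/-- The iterate `σ^n` of a substitution, on letters. -/
def iter {A : Type*} (σ : A → List A) : ℕ → A → List A
  | 0, a => [a]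
  | n + 1, a => applyS σ (iter σ n a)

/-- The Thue–Morse language: words that are factors of `M^n(a)` for some letter `a`,
for infinitely many `n`. -/
def LangTM : Set (List Bool) :=
  {w | {n : ℕ | ∃ a : Bool, w <:+: iter Msub n a}.Infinite}

/-- The composition of a finite list of substitutions (the identity for `[]`),
on letters. -/
def compList : List (Bool → List Bool) → Bool → List Bool
  | [], a => [a]
  | τ :: rest, a => applyS τ (compList rest a)

theorem occ_cons {A : Type*} [DecidableEq A] (v w : List A) (a : A) :
    occ v (a :: w) = (if v <+: a :: w then 1 else 0) + occ v w := by
  unfold occ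
  rw [List.length_cons, List.range_succ_eq_map, List.countP_cons, List.countP_map, add_comm]
  simp [Function.comp_def]

theorem applyS_nil {A B : Type*} (σ : A → List B) : applyS σ [] = [] := rfl

theorem applyS_cons {A B : Type*} (σ : A → List B) (a : A) (w : List A) :
    applyS σ (a :: w) = σ a ++ applyS σ w := rfl

theorem applyS_applyS {A B C : Type*} (τ : B → List C) (σ : A → List B) (w : List A) :
    applyS (fun a => applyS τ (σ a)) w = applyS τ (applyS σ w) := by
  induction w with
  | nil => rfl
  | cons a w ih =>
    rw [applyS_cons, applyS_cons, ih]
    simp [applyS]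

theorem applyS_singleton {A : Type*} (w : List A) : applyS (fun a => [a]) w = w := by
  induction w with
  | nil => rfl
  | cons a w ih => simp [applyS_cons, ih]

theorem applyS_Lsub_prefix_iff (v w : List Bool) :
    applyS Lsub v <+: applyS Lsub w ↔ v <+: w := by
  induction v generalizing w with
  | nil => simp [applyS_nil]
  | cons a v ih =>
    rcases w with _ | ⟨b, w⟩ <;> cases a <;> try cases b
    all_goals simp [applyS_cons, applyS_nil, Lsub, ih]

theorem applyS_Msub_prefix_iff (v w : List Bool) :
    applyS Msub v <+: applyS Msub w ↔ v <+: w := by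
  induction v generalizing w with
  | nil => simp [applyS_nil]
  | cons a v ih =>
    rcases w with _ | ⟨b, w⟩ <;> cases a <;> try cases b
    all_goals simp [applyS_cons, applyS_nil, Msub, ih]

theorem applyS_Rsub_prefix_iff (v w : List Bool) :
    applyS Rsub v <+: applyS Rsub w ↔ v <+: w := by
  induction v generalizing w with
  | nil => simp [applyS_nil]
  | cons a v ih =>
    rcases w with _ | ⟨b, w⟩ <;> cases a <;> try cases b
    all_goals simp [applyS_cons, applyS_nil, Rsub, ih]

theorem occ_applyS_Lsub (t x : List Bool) (h : ¬ true :: t <:+: x) :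
    occ (applyS Lsub (false :: t)) (applyS Lsub x) = occ (false :: t) x := by
  induction x with
  | nil => simp [applyS_cons, applyS_nil, Lsub, occ]
  | cons a x ih =>
    rw [List.infix_cons_iff, not_or] at h
    have ih := ih h.2
    cases a <;>
      simp_all [applyS_cons, Lsub, occ_cons, applyS_Lsub_prefix_iff]

theorem occ_applyS_Msub (t x : List Bool) :
    occ (applyS Msub (false :: true :: t)) (applyS Msub x) = occ (false :: true :: t) x := by
  induction x with
  | nil => simp [applyS_cons, applyS_nil, Msub, occ]
  | cons a x ih =>
    rcases x with _ | ⟨b, x⟩ <;> cases a <;> try cases b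
    all_goals simp_all [applyS_cons, applyS_nil, Msub, occ_cons, applyS_Msub_prefix_iff]

theorem occ_applyS_Rsub (t x : List Bool) :
    occ (applyS Rsub (false :: t)) (applyS Rsub x) = occ (false :: t) x := by
  induction x with
  | nil => simp [applyS_cons, applyS_nil, Rsub, occ]
  | cons a x ih =>
    cases a <;>
      simp_all [applyS_cons, Rsub, occ_cons, applyS_Rsub_prefix_iff]

theorem not_infix_applyS_Lsub (s x : List Bool) :
    ¬ true :: true :: s <:+: applyS Lsub x := by
  induction x with
  | nil => simp [applyS_nil]
  | cons a x ih => cases a <;> simp_all [applyS_cons, Lsub, List.infix_cons_iff]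

theorem not_infix_applyS_Msub (s x : List Bool) :
    ¬ true :: true :: true :: s <:+: applyS Msub x := by
  induction x with
  | nil => simp [applyS_nil]
  | cons a x ih =>
    rcases x with _ | ⟨b, x⟩ <;> cases a <;> try cases b
    all_goals simp_all [applyS_cons, applyS_nil, Msub, List.infix_cons_iff]

theorem not_infix_applyS_Rsub (t x : List Bool) (h : ¬ true :: t <:+: x) :
    ¬ true :: true :: applyS Rsub t <:+: applyS Rsub x := by
  have key (y : List Bool) : true :: applyS Rsub t <+: applyS Rsub y ↔ true :: t <+: y :=
    applyS_Rsub_prefix_iff (true :: t) y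
  induction x with
  | nil => simp [applyS_nil]
  | cons a x ih =>
    rw [List.infix_cons_iff, not_or] at h
    have ih := ih h.2
    have hx : ¬ true :: t <+: x := fun hp => h.2 hp.isInfix
    cases a <;> simp_all [applyS_cons, Rsub, List.infix_cons_iff]

theorem not_infix_of_mem_LangTM {w : List Bool} (hw : w ∈ LangTM) :
    ¬ [true, true, true] <:+: w := by
  obtain ⟨n, ⟨a, ha⟩, hn⟩ := Set.Infinite.exists_gt hw 0
  obtain ⟨m, rfl⟩ := Nat.exists_eq_succ_of_ne_zero hn.ne'
  exact fun h => not_infix_applyS_Msub [] _ (h.trans ha)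

/-- The image of `011` starts with `01`, and exchanging that first `0` for a `1` gives a word
that is not a factor of the image of `w`. -/
theorem exists_compList_image_eq (l : List (Bool → List Bool))
    (hl : ∀ τ ∈ l, τ = Lsub ∨ τ = Msub ∨ τ = Rsub) {w : List Bool} (hw : w ∈ LangTM) :
    ∃ t, applyS (compList l) [false, true, true] = false :: true :: t ∧
      ¬ true :: true :: t <:+: applyS (compList l) w ∧
      occ (false :: true :: t) (applyS (compList l) w) = occ [false, true, true] w := by
  induction l with
  | nil =>
    have h (v : List Bool) : applyS (compList []) v = v := applyS_singleton v
    simp only [h]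
    exact ⟨[true], rfl, not_infix_of_mem_LangTM hw, rfl⟩
  | cons τ l ih =>
    obtain ⟨t, ht, hni, hocc⟩ := ih fun σ hσ => hl σ (List.mem_cons_of_mem _ hσ)
    have h (v : List Bool) : applyS (compList (τ :: l)) v = applyS τ (applyS (compList l) v) :=
      applyS_applyS τ (compList l) v
    simp only [h, ht, ← hocc]
    rcases hl τ List.mem_cons_self with rfl | rfl | rfl
    · exact ⟨_, rfl, not_infix_applyS_Lsub _ _, occ_applyS_Lsub _ _ hni⟩
    · exact ⟨_, rfl, not_infix_applyS_Msub _ _, occ_applyS_Msub _ _⟩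
    · exact ⟨_, rfl, not_infix_applyS_Rsub _ _ hni, occ_applyS_Rsub _ _⟩

/-- for every `σ ∈ {L,M,R}*` and every word `w` in the Thue–Morse
language, `|σ(w)|_{σ(011)} = |w|_{011}`. -/
theorem occ_image_011 (l : List (Bool → List Bool))
    (hl : ∀ τ ∈ l, τ = Lsub ∨ τ = Msub ∨ τ = Rsub) :
    ∀ w ∈ LangTM,
      occ (applyS (compList l) [false, true, true]) (applyS (compList l) w) =
        occ [false, true, true] w := by
  intro w hw
  obtain ⟨t, ht, -, hocc⟩ := exists_compList_image_eq l hl hw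
  rw [ht, hocc]
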